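/- The cross-Wigner distribution W(f,g)(x,ξ) = ∫ f(x + t/2) conj(g(x − t/2)) e^{−2πi t·ξ} dt satisfies Moyal's identity: ⟨W(f₁,g₁), W(f₂,g₂)⟩_{L²(ℝ^{2d})} = ⟨f₁,f₂⟩_{L²(ℝ^d)} · conj(⟨g₁,g₂⟩_{L²(ℝ^d)}) for all f₁,f₂,g₁,g₂ ∈ L²(ℝ^d) (suitably interpreted via density of Schwartz functions). -/

import Mathlib

open MeasureTheory SchwartzMap
open scoped Real ComplexConjugate FourierTransform

namespace Moyal

/-- The correlation function whose Fourier transform in `t` is the Wigner distribution. -/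
noncomputable def H {d : ℕ} (f g : 𝓢((Fin d → ℝ), ℂ)) (x t : Fin d → ℝ) : ℂ :=
  f (x + (1/2 : ℝ) • t) * conj (g (x - (1/2 : ℝ) • t))

/-- The Wigner distribution. -/
noncomputable def Wig {d : ℕ} (f g : 𝓢((Fin d → ℝ), ℂ)) (z : (Fin d → ℝ) × (Fin d → ℝ)) : ℂ :=
  ∫ t : Fin d → ℝ, H f g z.1 t *
        Complex.exp (-2 * Real.pi * Complex.I * ((∑ i, t i * z.2 i : ℝ) : ℂ))

lemma continuous_H {d : ℕ} (f g : 𝓢((Fin d → ℝ), ℂ)) :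
    Continuous (fun p : (Fin d → ℝ) × (Fin d → ℝ) => H f g p.1 p.2) := by
  unfold H
  have hf := f.continuous
  have hg := g.continuous
  exact (hf.comp (by fun_prop)).mul (Complex.continuous_conj.comp (hg.comp (by fun_prop)))

lemma exists_comp {d : ℕ} (f : 𝓢((Fin d → ℝ), ℂ)) (x : Fin d → ℝ) (c : ℝ) (hc : c ≠ 0) :
    ∃ h : 𝓢(EuclideanSpace ℝ (Fin d), ℂ), ∀ v, h v = f (x + c • v.ofLp) := by
  let e : EuclideanSpace ℝ (Fin d) ≃L[ℝ] (Fin d → ℝ) :=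
    (EuclideanSpace.equiv (Fin d) ℝ).trans
      (ContinuousLinearEquiv.smulLeft (Units.mk0 c hc))
  let f' := SchwartzMap.compSubConstCLM ℂ (-x) f
  refine ⟨SchwartzMap.compCLMOfContinuousLinearEquiv ℂ e f', fun v => ?_⟩
  have : e v = c • v.ofLp := rfl
  simp [f', this, add_comm]

lemma exists_schwartz {d : ℕ} (f g : 𝓢((Fin d → ℝ), ℂ)) (x : Fin d → ℝ) :
    ∃ h : 𝓢(EuclideanSpace ℝ (Fin d), ℂ), ∀ v, h v = H f g x v.ofLp := by
  obtain ⟨a, ha⟩ := exists_comp f x (1/2) (by norm_num)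
  obtain ⟨b, hb⟩ := exists_comp g x (-(1/2)) (by norm_num)
  let b' : 𝓢(EuclideanSpace ℝ (Fin d), ℂ) :=
    b.postcompCLM (𝕜 := ℝ) (Complex.conjCLE : ℂ →L[ℝ] ℂ)
  refine ⟨SchwartzMap.pairing (ContinuousLinearMap.mul ℂ ℂ) a b', fun v => ?_⟩
  rw [SchwartzMap.pairing_apply_apply]
  have : b' v = conj (b v) := rfl
  rw [this, ContinuousLinearMap.mul_apply', ha, hb, H, neg_smul, ← sub_eq_add_neg]

lemma integral_ofLp {d : ℕ} {E : Type*} [NormedAddCommGroup E] [NormedSpace ℝ E]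
    (F : (Fin d → ℝ) → E) :
    ∫ v : EuclideanSpace ℝ (Fin d), F v.ofLp = ∫ t, F t :=
  (PiLp.volume_preserving_ofLp (Fin d)).integral_comp
    (MeasurableEquiv.toLp 2 (Fin d → ℝ)).symm.measurableEmbedding F

lemma integrable_ofLp {d : ℕ} {E : Type*} [NormedAddCommGroup E] 
    (F : (Fin d → ℝ) → E) :
    Integrable (fun v : EuclideanSpace ℝ (Fin d) => F v.ofLp) ↔ Integrable F :=
  (PiLp.volume_preserving_ofLp (Fin d)).integrable_comp_emb
    (MeasurableEquiv.toLp 2 (Fin d → ℝ)).symm.measurableEmbedding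

lemma fourier_eq_Wig {d : ℕ} (f g : 𝓢((Fin d → ℝ), ℂ)) (x : Fin d → ℝ)
    (h : 𝓢(EuclideanSpace ℝ (Fin d), ℂ)) (hh : ∀ v, h v = H f g x v.ofLp)
    (ξ : EuclideanSpace ℝ (Fin d)) : (𝓕 h) ξ = Wig f g (x, ξ.ofLp) := by
  rw [SchwartzMap.fourier_coe, Real.fourier_eq', Wig, ← integral_ofLp]
  congr 1
  ext v
  rw [hh, smul_eq_mul, mul_comm]
  congr 2
  rw [PiLp.inner_apply]
  simp only [RCLike.inner_apply, conj_trivial, mul_comm]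
  push_cast
  ring

lemma plancherel {d : ℕ} (f₁ f₂ g₁ g₂ : 𝓢((Fin d → ℝ), ℂ)) (x : Fin d → ℝ) :
    ∫ ξ, Wig f₁ g₁ (x, ξ) * conj (Wig f₂ g₂ (x, ξ)) =
      ∫ t, H f₁ g₁ x t * conj (H f₂ g₂ x t) := by
  obtain ⟨h₁, hh₁⟩ := exists_schwartz f₁ g₁ x
  obtain ⟨h₂, hh₂⟩ := exists_schwartz f₂ g₂ x
  have := SchwartzMap.integral_inner_fourier_fourier h₂ h₁
  simp only [RCLike.inner_apply, fourier_eq_Wig f₁ g₁ x h₁ hh₁, fourier_eq_Wig f₂ g₂ x h₂ hh₂,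
    hh₁, hh₂] at this
  rwa [integral_ofLp (fun ξ => Wig f₁ g₁ (x, ξ) * conj (Wig f₂ g₂ (x, ξ))),
    integral_ofLp (fun t => H f₁ g₁ x t * conj (H f₂ g₂ x t))] at this

lemma plancherel_sq {d : ℕ} (f g : 𝓢((Fin d → ℝ), ℂ)) (x : Fin d → ℝ) :
    ∫ ξ, ‖Wig f g (x, ξ)‖ ^ 2 = ∫ t, ‖H f g x t‖ ^ 2 := by
  obtain ⟨h₁, hh₁⟩ := exists_schwartz f g x
  have := SchwartzMap.integral_norm_sq_fourier h₁
  simp only [fourier_eq_Wig f g x h₁ hh₁, hh₁] at this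
  rwa [integral_ofLp (fun ξ => ‖Wig f g (x, ξ)‖ ^ 2),
    integral_ofLp (fun t => ‖H f g x t‖ ^ 2)] at this

lemma integrable_sq {d : ℕ} (f g : 𝓢((Fin d → ℝ), ℂ)) (x : Fin d → ℝ) :
    Integrable (fun ξ => ‖Wig f g (x, ξ)‖ ^ 2) := by
  obtain ⟨h, hh⟩ := exists_schwartz f g x
  have := ((𝓕 h).memLp 2 volume).integrable_norm_pow (by norm_num)
  simp only [fourier_eq_Wig f g x h hh] at this
  exact (integrable_ofLp (fun ξ => ‖Wig f g (x, ξ)‖ ^ 2)).1 (by simpa using this)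

lemma measurePreserving {d : ℕ} :
    MeasurePreserving (fun p : (Fin d → ℝ) × (Fin d → ℝ) =>
      (p.1 + (1/2 : ℝ) • p.2, p.1 - (1/2 : ℝ) • p.2)) := by
  have A : MeasurePreserving (fun p : (Fin d → ℝ) × (Fin d → ℝ) =>
      (p.1, p.2 + (1/2 : ℝ) • p.1)) (volume.prod volume) (volume.prod volume) :=
    (MeasurePreserving.id volume).skew_product
      (g := fun t x => x + (1/2 : ℝ) • t) (by fun_prop)
      (Filter.Eventually.of_forall fun t => (measurePreserving_add_right volume _).map_eq)
  have B : MeasurePreserving (fun p : (Fin d → ℝ) × (Fin d → ℝ) =>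
      (p.1, p.1 - p.2)) (volume.prod volume) (volume.prod volume) :=
    (MeasurePreserving.id volume).skew_product
      (g := fun u t => u - t) (by fun_prop)
      (Filter.Eventually.of_forall fun t => (Measure.measurePreserving_sub_left volume _).map_eq)
  have C := B.comp (Measure.measurePreserving_swap.comp (A.comp Measure.measurePreserving_swap))
  convert C using 1
  ext p i
  · simp
  · simp
    ring
  · rfl
  · rfl

lemma aesm_Wig {d : ℕ} (f g : 𝓢((Fin d → ℝ), ℂ)) : StronglyMeasurable (Wig f g) := by
  unfold Wig
  apply StronglyMeasurable.integral_prod_right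
    (f := fun (z : (Fin d → ℝ) × (Fin d → ℝ)) (t : Fin d → ℝ) => H f g z.1 t *
        Complex.exp (-2 * Real.pi * Complex.I * ((∑ i, t i * z.2 i : ℝ) : ℂ)))
  apply Continuous.stronglyMeasurable
  exact ((continuous_H f g).comp (by fun_prop : Continuous
    fun p : ((Fin d → ℝ) × (Fin d → ℝ)) × (Fin d → ℝ) => (p.1.1, p.2))).mul
    (by fun_prop)

lemma integrable_H_sq {d : ℕ} (f g : 𝓢((Fin d → ℝ), ℂ)) :
    Integrable (fun p : (Fin d → ℝ) × (Fin d → ℝ) => ‖H f g p.1 p.2‖ ^ 2) := by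
  have hf := (f.memLp 2 volume).integrable_norm_pow (by norm_num)
  have hg := (g.memLp 2 volume).integrable_norm_pow (by norm_num)
  have := measurePreserving.integrable_comp_of_integrable (hf.mul_prod hg)
  refine this.congr (Filter.Eventually.of_forall fun p => ?_)
  simp [H, mul_pow]

lemma integrable_Wig_sq {d : ℕ} (f g : 𝓢((Fin d → ℝ), ℂ)) :
    Integrable (fun z => ‖Wig f g z‖ ^ 2) := by
  refine (integrable_prod_iff
    ((aesm_Wig f g).norm.pow 2).aestronglyMeasurable).2 ⟨?_, ?_⟩
  · exact Filter.Eventually.of_forall fun x => integrable_sq f g x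
  · simp only [Pi.pow_apply, norm_pow, norm_norm, plancherel_sq]
    exact (integrable_H_sq f g).integral_prod_left

lemma integrable_mul_conj {α : Type*} [MeasurableSpace α] {μ : Measure α} {u v : α → ℂ}
    (hu : AEStronglyMeasurable u μ) (hv : AEStronglyMeasurable v μ)
    (hu2 : Integrable (fun z => ‖u z‖ ^ 2) μ) (hv2 : Integrable (fun z => ‖v z‖ ^ 2) μ) :
    Integrable (fun z => u z * conj (v z)) μ := by
  refine (hu2.add hv2).mono' (hu.mul (Complex.continuous_conj.comp_aestronglyMeasurable hv))
    (Filter.Eventually.of_forall fun z => ?_)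
  simp only [norm_mul, RCLike.norm_conj, Pi.add_apply]
  nlinarith [sq_nonneg (‖u z‖ - ‖v z‖), sq_nonneg (‖u z‖), sq_nonneg (‖v z‖)]

theorem main {d : ℕ} (f₁ f₂ g₁ g₂ : 𝓢((Fin d → ℝ), ℂ)) :
    ∫ z, Wig f₁ g₁ z * conj (Wig f₂ g₂ z) =
      (∫ t : Fin d → ℝ, f₁ t * conj (f₂ t)) * conj (∫ t : Fin d → ℝ, g₁ t * conj (g₂ t)) := by
  have h1 : Integrable (fun z => Wig f₁ g₁ z * conj (Wig f₂ g₂ z)) :=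
    integrable_mul_conj (aesm_Wig _ _).aestronglyMeasurable (aesm_Wig _ _).aestronglyMeasurable
      (integrable_Wig_sq _ _) (integrable_Wig_sq _ _)
  have h2 : Integrable (fun p : (Fin d → ℝ) × (Fin d → ℝ) =>
      H f₁ g₁ p.1 p.2 * conj (H f₂ g₂ p.1 p.2)) :=
    integrable_mul_conj (continuous_H _ _).aestronglyMeasurable
      (continuous_H _ _).aestronglyMeasurable (integrable_H_sq _ _) (integrable_H_sq _ _)
  have e1 := integral_prod _ h1
  have e2 := integral_prod _ h2
  simp only [plancherel] at e1
  refine (e1.trans e2.symm).trans ?_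
  rw [← integral_conj, ← integral_prod_mul, ← Measure.volume_eq_prod]
  have hc : Continuous (fun p : (Fin d → ℝ) × (Fin d → ℝ) =>
      f₁ p.1 * conj (f₂ p.1) * conj (g₁ p.2 * conj (g₂ p.2))) := by
    have := f₁.continuous
    have := f₂.continuous
    have := g₁.continuous
    have := g₂.continuous
    have := Complex.continuous_conj
    fun_prop
  have hm := measurePreserving (d := d)
  conv_rhs => rw [← hm.map_eq]
  rw [integral_map hm.measurable.aemeasurable hc.aestronglyMeasurable]
  congr 1
  ext p
  simp only [H, map_mul, Complex.conj_conj]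
  ring

end Moyal

/-- Moyal's identity for the cross-Wigner distribution (stated on Schwartz functions,
by which the L² case is interpreted via density):
`⟨W(f₁,g₁), W(f₂,g₂)⟩_{L²(ℝ^{2d})} = ⟨f₁,f₂⟩ conj(⟨g₁,g₂⟩)`,
where all inner products are conjugate-linear in the second slot. -/
theorem stmt_8 (d : ℕ) (hd : 1 ≤ d)
    (f₁ f₂ g₁ g₂ : 𝓢((Fin d → ℝ), ℂ))
    (W : 𝓢((Fin d → ℝ), ℂ) → 𝓢((Fin d → ℝ), ℂ) → ((Fin d → ℝ) × (Fin d → ℝ)) → ℂ)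
    (hW : ∀ f g x ξ, W f g (x, ξ) =
      ∫ t : Fin d → ℝ, f (x + (1/2 : ℝ) • t) * conj (g (x - (1/2 : ℝ) • t)) *
        Complex.exp (-2 * Real.pi * Complex.I * ((∑ i, t i * ξ i : ℝ) : ℂ))) :
    ∫ z : (Fin d → ℝ) × (Fin d → ℝ), W f₁ g₁ z * conj (W f₂ g₂ z) =
      (∫ t : Fin d → ℝ, f₁ t * conj (f₂ t)) * conj (∫ t : Fin d → ℝ, g₁ t * conj (g₂ t)) := by
  have hWW : ∀ f g, W f g = Moyal.Wig f g := by
    intro f g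
    funext z
    exact hW f g z.1 z.2
  simp only [hWW]
  exact Moyal.main f₁ f₂ g₁ g₂
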